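/- Suppose a finite group G has a perfect basis (g₁,…,g_n) with m_i = order(g_i), and let α = ∑ q^{c₁+⋯+c_n}·g where g = g₁^{c₁}⋯g_n^{c_n} ranges over G. Then the determinant of the regular representation applied to α equals ∏_{i=1}^n (1 − q^{m_i})^{|G|(1 − 1/m_i)}. -/

import Mathlib

open Polynomial in
theorem det_cyclic_pow (k : ℕ) :
    Matrix.det (Matrix.of fun a b : Fin (k + 1) => (X : ℚ[X]) ^ ((a - b : Fin (k + 1)) : ℕ)) =
      (1 - X ^ (k + 1)) ^ k := by
  have hval : ∀ a b : Fin (k + 1), ((a - b : Fin (k + 1)) : ℕ) =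
      if (b : ℕ) ≤ a then (a : ℕ) - b else k + 1 + a - b := by
    intro a b
    split_ifs with h
    · exact Fin.sub_val_of_le h
    · exact Fin.coe_sub_iff_lt.mpr (Fin.lt_def.mpr (not_le.mp h))
  let B : Matrix (Fin (k + 1)) (Fin (k + 1)) ℚ[X] := Matrix.of fun i j =>
    if i = 0 then X ^ ((0 - j : Fin (k + 1)) : ℕ) else if i = j then 1 - X ^ (k + 1) else 0
  have hB : B.IsUpperTriangular := by
    intro i j hij
    have hij : j < i := hij
    have h0 : i ≠ 0 := (Fin.zero_le j |>.trans_lt hij).ne'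
    simp [B, h0, hij.ne']
  rw [Matrix.det_eq_of_forall_row_eq_smul_add_pred (B := B) (fun _ => X),
    Matrix.det_of_isUpperTriangular hB, Fin.prod_univ_succ]
  · simp [B]
  · intro j
    simp [B]
  · intro i j
    simp only [Matrix.of_apply, B, hval, Fin.val_succ, Fin.val_castSucc, Fin.ext_iff,
      Fin.val_zero, Nat.succ_ne_zero, if_false]
    have hi := i.isLt
    have hj := j.isLt
    rw [← pow_succ']
    split_ifs with h1 h2 h3 h4 h5
    all_goals first
      | omega
      | (rw [zero_add]; congr 1; omega)
      | (rw [show (i : ℕ) + 1 - j = 0 by omega, show k + 1 + (i : ℕ) - j + 1 = k + 1 by omega]; ring)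

/-- The left regular representation by permutation matrices. -/
def leftRegularMatrix (R G : Type*) [CommRing R] [Group G] [Fintype G] [DecidableEq G] :
    G →* Matrix G G R where
  toFun g := Matrix.of fun u v => if u = g * v then 1 else 0
  map_one' := by
    ext u v
    simp [Matrix.one_apply]
  map_mul' g h := by
    ext u v
    simp [Matrix.mul_apply, mul_assoc]

theorem leftRegularMatrix_apply {R G : Type*} [CommRing R] [Group G] [Fintype G] [DecidableEq G]
    (g u v : G) : leftRegularMatrix R G g u v = if u = g * v then 1 else 0 := rfl

/-- Coordinates on a finite group given by the right cosets of a cyclic subgroup. -/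
theorem bijective_pow_mul_out_inv {G : Type*} [Group G] [Fintype G] (g : G) (k : ℕ)
    (hk : orderOf g = k + 1) :
    Function.Bijective fun p : Fin (k + 1) × (G ⧸ Subgroup.zpowers g) =>
      g ^ (p.1 : ℕ) * p.2.out⁻¹ := by
  classical
  have := Fintype.ofFinite (G ⧸ Subgroup.zpowers g)
  rw [Fintype.bijective_iff_injective_and_card]
  constructor
  · rintro ⟨a, x⟩ ⟨b, y⟩ h
    have h : g ^ (a : ℕ) * x.out⁻¹ = g ^ (b : ℕ) * y.out⁻¹ := h
    have hxy : x = y := by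
      rw [← x.out_eq', ← y.out_eq']
      refine QuotientGroup.eq.mpr ?_
      have : x.out⁻¹ * y.out = (g ^ (a : ℕ))⁻¹ * g ^ (b : ℕ) := by
        rw [eq_inv_mul_iff_mul_eq, ← mul_assoc, h, inv_mul_cancel_right]
      rw [this]
      exact mul_mem (inv_mem (Subgroup.npow_mem_zpowers g _)) (Subgroup.npow_mem_zpowers g _)
    subst hxy
    have hab := pow_injOn_Iio_orderOf (a.isLt.trans_eq hk.symm)
      (b.isLt.trans_eq hk.symm) (mul_right_cancel h)
    simp [Fin.ext_iff, hab]
  · have h := Subgroup.card_eq_card_quotient_mul_card_subgroup (Subgroup.zpowers g)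
    rw [Nat.card_zpowers, hk, Nat.card_eq_fintype_card, Nat.card_eq_fintype_card] at h
    simp [h, mul_comm]

open Polynomial in
theorem det_sum_pow_leftRegularMatrix {G : Type*} [Group G] [Fintype G] [DecidableEq G]
    (g : G) (m : ℕ) (hm : m = orderOf g) :
    Matrix.det (∑ c : Fin m, (X : ℚ[X]) ^ (c : ℕ) • leftRegularMatrix ℚ[X] G (g ^ (c : ℕ))) =
      (1 - X ^ m) ^ (Fintype.card G - Fintype.card G / m) := by
  classical
  obtain ⟨k, rfl⟩ : ∃ k, m = k + 1 :=
    Nat.exists_eq_succ_of_ne_zero (hm ▸ (orderOf_pos g).ne')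
  have := Fintype.ofFinite (G ⧸ Subgroup.zpowers g)
  let E := Equiv.ofBijective _ (bijective_pow_mul_out_inv g k hm.symm)
  have hE : ∀ p, E p = g ^ (p.1 : ℕ) * p.2.out⁻¹ := fun _ => rfl
  have hcard : Fintype.card G = (k + 1) * Fintype.card (G ⧸ Subgroup.zpowers g) := by
    rw [← Fintype.card_congr E, Fintype.card_prod, Fintype.card_fin]
  have hmul : ∀ (c b : Fin (k + 1)) (x : G ⧸ Subgroup.zpowers g),
      g ^ (c : ℕ) * E (b, x) = E (c + b, x) := by
    intro c b x
    rw [hE, hE, ← mul_assoc, ← pow_add, Fin.val_add, ← pow_mod_orderOf g (c + b), ← hm]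
  rw [← Matrix.det_submatrix_equiv_self E]
  have hblock : (∑ c : Fin (k + 1),
      (X : ℚ[X]) ^ (c : ℕ) • leftRegularMatrix ℚ[X] G (g ^ (c : ℕ))).submatrix E E =
      Matrix.blockDiagonal fun _ : G ⧸ Subgroup.zpowers g =>
        Matrix.of fun a b : Fin (k + 1) => (X : ℚ[X]) ^ ((a - b : Fin (k + 1)) : ℕ) := by
    ext1 ⟨a, x⟩ ⟨b, y⟩
    simp only [Matrix.submatrix_apply, Matrix.sum_apply, Matrix.smul_apply,
      leftRegularMatrix_apply, hmul, E.injective.eq_iff, Prod.mk.injEq,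
      Matrix.blockDiagonal_apply, Matrix.of_apply, ← sub_eq_iff_eq_add]
    by_cases hxy : x = y <;> simp [hxy]
  rw [hblock, Matrix.det_blockDiagonal, Finset.prod_const, det_cyclic_pow, ← pow_mul, hcard,
    Nat.mul_div_cancel_left _ k.succ_pos, Finset.card_univ]
  congr 1
  rw [add_mul, one_mul, Nat.add_sub_cancel]

/-- If `G` has a perfect basis `(g₁,…,gₙ)` with `mᵢ = order(gᵢ)` and
`α = ∑ q^{c₁+⋯+cₙ}·g`, then the group determinant (the determinant of the regular
representation applied to `α`) equals `∏ᵢ (1 - q^{mᵢ})^{|G|(1 - 1/mᵢ)}`. -/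
theorem stmt5 {G : Type*} [Group G] [Fintype G] [DecidableEq G] {n : ℕ}
    (g : Fin n → G) (m : Fin n → ℕ) (hm : ∀ i, m i = orderOf (g i))
    (e : (∀ i : Fin n, Fin (m i)) ≃ G)
    (he : ∀ c, e c = (List.ofFn fun i => g i ^ ((c i : ℕ))).prod) :
    Matrix.det (Matrix.of fun u v : G =>
        (Polynomial.X : Polynomial ℚ) ^ (∑ i, ((e.symm (u * v⁻¹)) i : ℕ))) =
      ∏ i, (1 - (Polynomial.X : Polynomial ℚ) ^ (m i)) ^
        (Fintype.card G - Fintype.card G / m i) := by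

  have hprod : Matrix.of (fun u v : G =>
        (Polynomial.X : Polynomial ℚ) ^ (∑ i, ((e.symm (u * v⁻¹)) i : ℕ))) =
      (List.ofFn fun i => ∑ c : Fin (m i), (Polynomial.X : Polynomial ℚ) ^ (c : ℕ) •
        leftRegularMatrix (Polynomial ℚ) G (g i ^ (c : ℕ))).prod := by
    have h := (MultilinearMap.mkPiAlgebraFin (Polynomial ℚ) n
      (Matrix G G (Polynomial ℚ))).map_sum fun i (c : Fin (m i)) =>
        (Polynomial.X : Polynomial ℚ) ^ (c : ℕ) •
          leftRegularMatrix (Polynomial ℚ) G (g i ^ (c : ℕ))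
    simp only [MultilinearMap.map_smul_univ, MultilinearMap.mkPiAlgebraFin_apply] at h
    rw [h]
    have hc : ∀ c : ∀ i, Fin (m i),
        (List.ofFn fun i => leftRegularMatrix (Polynomial ℚ) G (g i ^ (c i : ℕ))).prod =
          leftRegularMatrix (Polynomial ℚ) G (e c) := by
      intro c
      rw [he, map_list_prod, List.map_ofFn]
      rfl
    ext1 u v
    simp only [hc, Finset.prod_pow_eq_pow_sum, Matrix.of_apply, Matrix.sum_apply,
      Matrix.smul_apply, leftRegularMatrix_apply, ← mul_inv_eq_iff_eq_mul,
      ← Equiv.symm_apply_eq]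
    simp
  rw [hprod, ← Matrix.coe_detMonoidHom, map_list_prod, List.map_ofFn, List.prod_ofFn]
  exact Finset.prod_congr rfl fun i _ => det_sum_pow_leftRegularMatrix (g i) (m i) (hm i)
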